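/- arXiv:2408.01135 — 3 statements merged into one kernel-verified Lean document; each statement's English description precedes it below -/
import Mathlib

section
/- Let X be a real Banach space. The following are equivalent: (1) X is weakly sequentially complete; (2) every bounded sequence in X has a subsequence which is either convergent in the weak topology or equivalent to the canonical basis of ℓ1; (3) every weakly precompact subset of X is relatively weakly compact. -/
open Filter Topology Bornology

/-- A sequence is equivalent to the canonical basis of `ℓ₁` if there are constants
`0 < c` and `0 < C` with `c * ∑ |aᵢ| ≤ ‖∑ aᵢ • xᵢ‖ ≤ C * ∑ |aᵢ|` for all finite scalar choices. -/
def IsEquivL1Basis {X : Type*} [NormedAddCommGroup X] [NormedSpace ℝ X] (x : ℕ → X) : Prop :=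
  ∃ c C : ℝ, 0 < c ∧ 0 < C ∧ ∀ (n : ℕ) (a : Fin n → ℝ),
    c * ∑ i, |a i| ≤ ‖∑ i, a i • x (i : ℕ)‖ ∧ ‖∑ i, a i • x (i : ℕ)‖ ≤ C * ∑ i, |a i|

/-- A bounded set is weakly precompact if it contains no sequence equivalent to the
canonical basis of `ℓ₁`. -/
def WeaklyPrecompact {X : Type*} [NormedAddCommGroup X] [NormedSpace ℝ X] (A : Set X) : Prop :=
  IsBounded A ∧ ∀ x : ℕ → X, (∀ n, x n ∈ A) → ¬ IsEquivL1Basis x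

/-- A sequence is weakly Cauchy if `(f (x n))` converges for every continuous linear functional. -/
def IsWeaklyCauchy {X : Type*} [NormedAddCommGroup X] [NormedSpace ℝ X] (x : ℕ → X) : Prop :=
  ∀ f : X →L[ℝ] ℝ, ∃ l : ℝ, Tendsto (fun n => f (x n)) atTop (𝓝 l)

/-- Convergence of a sequence in the weak topology. -/
def WeaklyConvergesTo {X : Type*} [NormedAddCommGroup X] [NormedSpace ℝ X]
    (x : ℕ → X) (l : X) : Prop :=
  Tendsto (fun n => toWeakSpace ℝ X (x n)) atTop (𝓝 (toWeakSpace ℝ X l))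

/-- A set is relatively weakly compact if its closure in the weak topology is compact there. -/
def RelWeaklyCompact {X : Type*} [NormedAddCommGroup X] [NormedSpace ℝ X] (A : Set X) : Prop :=
  IsCompact (closure (toWeakSpace ℝ X '' A))

/-- `b ∈ T` oscillates between the two families along `N`. -/
def RosOsc {S : Type*} (C : Bool → ℕ → Set S) (T : Set S) (N : Set ℕ) : Prop :=
  ∃ b ∈ T, ∀ ε : Bool, {n | n ∈ N ∧ b ∈ C ε n}.Infinite

/-- No infinite subset of `M` is convergent on `T`. -/
def RosBad {S : Type*} (C : Bool → ℕ → Set S) (T : Set S) (M : Set ℕ) : Prop :=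
  ∀ N ⊆ M, N.Infinite → RosOsc C T N

theorem ros_diag {σ : Type*} (Ms : σ → Set ℕ) (R : σ → ℕ → σ → Prop)
    (step : ∀ s, ∃ j ∈ Ms s, ∃ s', Ms s' ⊆ Ms s ∧ (∀ m ∈ Ms s', j < m) ∧ R s j s') (s0 : σ) :
    ∃ (st : ℕ → σ) (j : ℕ → ℕ), st 0 = s0 ∧ StrictMono j ∧
      (∀ k, R (st k) (j k) (st (k + 1))) ∧ ∀ k l, k ≤ l → j l ∈ Ms (st k) := by
  choose J hJ nx hsub hlt hR using step
  let st : ℕ → σ := fun n => Nat.rec s0 (fun _ s => nx s) n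
  have hst : ∀ n, st (n + 1) = nx (st n) := fun n => rfl
  have hanti : Antitone (fun n => Ms (st n)) :=
    antitone_nat_of_succ_le (fun n => by simpa only [hst] using hsub (st n))
  refine ⟨st, fun n => J (st n), rfl, ?_, ?_, ?_⟩
  · refine strictMono_nat_of_lt_succ (fun n => ?_)
    apply hlt
    rw [← hst]
    exact hJ _
  · intro k
    rw [hst]
    exact hR _
  · intro k l hkl
    exact hanti hkl (hJ _)

theorem ros_infinite_inter_Ioi {M : Set ℕ} (hM : M.Infinite) (j : ℕ) :
    (M ∩ Set.Ioi j).Infinite := by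
  have : M ∩ Set.Ioi j = M \ Set.Iic j := by ext; simp
  rw [this]
  exact hM.sdiff (Set.finite_Iic j)

theorem ros_split {S : Type*} (C : Bool → ℕ → Set S) (𝒯 : Set (Set S)) (h𝒯 : 𝒯.Finite)
    (M : Set ℕ) (hM : M.Infinite) (hbad : ∀ T ∈ 𝒯, RosBad C T M) :
    ∃ j ∈ M, ∃ M' ⊆ M, M'.Infinite ∧ (∀ m ∈ M', j < m) ∧
      ∀ T ∈ 𝒯, ∀ ε, RosBad C (T ∩ C ε j) M' := by
  by_contra hcon
  push Not at hcon
  let σ := {N : Set ℕ // N ⊆ M ∧ N.Infinite}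
  have step : ∀ s : σ, ∃ j ∈ s.1, ∃ s' : σ, s'.1 ⊆ s.1 ∧ (∀ m ∈ s'.1, j < m) ∧
      ∃ p : 𝒯 × Bool, ¬ RosOsc C (p.1.1 ∩ C p.2 j) s'.1 := by
    rintro ⟨N, hNM, hN⟩
    obtain ⟨j, hj⟩ := hN.nonempty
    obtain ⟨T, hT, ε, hb⟩ := hcon j (hNM hj) (N ∩ Set.Ioi j)
      (Set.inter_subset_left.trans hNM) (ros_infinite_inter_Ioi hN j) (fun m hm => hm.2)
    unfold RosBad at hb
    push Not at hb
    obtain ⟨N', hN', hinf, hosc⟩ := hb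
    exact ⟨j, hj, ⟨N', fun n hn => hNM (hN' hn).1, hinf⟩, fun n hn => (hN' hn).1,
      fun m hm => (hN' hm).2, (⟨T, hT⟩, ε), hosc⟩
  obtain ⟨st, j, h0, hmono, hR, hmem⟩ := ros_diag (fun s : σ => s.1) _ step ⟨M, subset_rfl, hM⟩
  choose p hp using hR
  have : Finite 𝒯 := h𝒯
  obtain ⟨⟨T, ε⟩, hfib⟩ := Finite.exists_infinite_fiber p
  have hK : (p ⁻¹' {(T, ε)}).Infinite := Set.infinite_coe_iff.1 hfib
  obtain ⟨b, hbT, hb⟩ := hbad T.1 T.2 (j '' (p ⁻¹' {(T, ε)}))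
    (by rintro _ ⟨k, -, rfl⟩; exact (st 0).2.1 (hmem 0 k (Nat.zero_le _)))
    (hK.image hmono.injective.injOn)
  obtain ⟨_, ⟨k, hk, rfl⟩, hbk⟩ := (hb ε).nonempty
  have hk' : p k = (T, ε) := hk
  apply hp k
  rw [hk']
  refine ⟨b, ⟨hbT, hbk⟩, fun ε' => ?_⟩
  refine (ros_infinite_inter_Ioi (hb ε') (j k)).mono ?_
  rintro _ ⟨⟨⟨l, hl, rfl⟩, hb'⟩, hlt⟩
  exact ⟨hmem _ _ (hmono.lt_iff_lt.1 hlt), hb'⟩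

theorem ros_indep {S : Type*} (C : Bool → ℕ → Set S)
    (M : Set ℕ) (hM : M.Infinite) (hbad : RosBad C Set.univ M) :
    ∃ j : ℕ → ℕ, StrictMono j ∧ ∀ (n : ℕ) (ε : ℕ → Bool), ∃ b, ∀ i < n, b ∈ C (ε i) (j i) := by
  let σ := {q : Set (Set S) × Set ℕ // q.1.Finite ∧ q.2.Infinite ∧ ∀ T ∈ q.1, RosBad C T q.2}
  have step : ∀ s : σ, ∃ j ∈ s.1.2, ∃ s' : σ, s'.1.2 ⊆ s.1.2 ∧ (∀ m ∈ s'.1.2, j < m) ∧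
      ∀ T ∈ s.1.1, ∀ ε, T ∩ C ε j ∈ s'.1.1 := by
    rintro ⟨⟨𝒯, N⟩, hfin, hN, hb⟩
    obtain ⟨j, hj, M', hM', hinf, hlt, hb'⟩ := ros_split C 𝒯 hfin N hN hb
    refine ⟨j, hj, ⟨⟨⋃ ε, (fun T => T ∩ C ε j) '' 𝒯, M'⟩,
      Set.finite_iUnion (fun ε => hfin.image _), hinf, ?_⟩, hM', hlt, ?_⟩
    · intro T hT
      obtain ⟨ε, T', hT', rfl⟩ := Set.mem_iUnion.1 hT
      exact hb' T' hT' ε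
    · intro T hT ε
      exact Set.mem_iUnion.2 ⟨ε, T, hT, rfl⟩
  obtain ⟨st, j, h0, hmono, hR, hmem⟩ := ros_diag (fun s : σ => s.1.2) _ step
    ⟨⟨{Set.univ}, M⟩, Set.finite_singleton _, hM, by simpa using hbad⟩
  refine ⟨j, hmono, fun n ε => ?_⟩
  have key : ∀ n, {b | ∀ i < n, b ∈ C (ε i) (j i)} ∈ (st n).1.1 := by
    intro n
    induction n with
    | zero => rw [h0]; simp
    | succ k ih =>
      convert hR k _ ih (ε k) using 1
      ext b
      simp only [Set.mem_ofPred_eq, Set.mem_inter_iff, Nat.lt_succ_iff_lt_or_eq]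
      constructor
      · intro h
        exact ⟨fun i hi => h i (Or.inl hi), h k (Or.inr rfl)⟩
      · rintro ⟨h1, h2⟩ i (hi | rfl)
        · exact h1 i hi
        · exact h2
  obtain ⟨b, hb, -⟩ := (st n).2.2.2 _ (key n) _ subset_rfl (st n).2.2.1
  exact ⟨b, hb⟩

theorem ros_exists_bad {X : Type*} [NormedAddCommGroup X] [NormedSpace ℝ X] (x : ℕ → X)
    (R : ℝ) (hx : ∀ n, ‖x n‖ ≤ R)
    (hno : ∀ φ : ℕ → ℕ, StrictMono φ → ¬ IsWeaklyCauchy (x ∘ φ)) :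
    ∃ r s : ℝ, r < s ∧ ∃ M : Set ℕ, M.Infinite ∧
      RosBad (S := {f : X →L[ℝ] ℝ // ‖f‖ ≤ 1})
        (fun ε n => if ε then {f | s < f.1 (x n)} else {f | f.1 (x n) < r}) Set.univ M := by
  by_contra hcon
  push Not at hcon
  obtain ⟨e, he⟩ := exists_surjective_nat (ℚ × ℚ)
  let C : ℝ → ℝ → Bool → ℕ → Set {f : X →L[ℝ] ℝ // ‖f‖ ≤ 1} := fun r s ε n =>
    if ε then {f | s < f.1 (x n)} else {f | f.1 (x n) < r}
  let σ := ℕ × {N : Set ℕ // N.Infinite}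
  have step : ∀ s : σ, ∃ j ∈ s.2.1, ∃ s' : σ, s'.2.1 ⊆ s.2.1 ∧ (∀ m ∈ s'.2.1, j < m) ∧
      (s'.1 = s.1 + 1 ∧ ((e s.1).1 < (e s.1).2 →
        ¬ RosOsc (C (e s.1).1 (e s.1).2) Set.univ s'.2.1)) := by
    rintro ⟨k, N, hN⟩
    obtain ⟨j, hj⟩ := hN.nonempty
    by_cases hlt : (e k).1 < (e k).2
    · have := hcon (e k).1 (e k).2 (by exact_mod_cast hlt) (N ∩ Set.Ioi j)
        (ros_infinite_inter_Ioi hN j)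
      unfold RosBad at this
      push Not at this
      obtain ⟨N', hN', hinf, hosc⟩ := this
      exact ⟨j, hj, ⟨k + 1, N', hinf⟩, fun n hn => (hN' hn).1, fun n hn => (hN' hn).2, rfl,
        fun _ => hosc⟩
    · exact ⟨j, hj, ⟨k + 1, N ∩ Set.Ioi j, ros_infinite_inter_Ioi hN j⟩, fun n hn => hn.1,
        fun n hn => hn.2, rfl, fun h => absurd h hlt⟩
  obtain ⟨st, j, h0, hmono, hR, hmem⟩ := ros_diag (fun s : σ => s.2.1) _ step
    ⟨0, Set.univ, Set.infinite_univ⟩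
  have hidx : ∀ k, (st k).1 = k := by
    intro k
    induction k with
    | zero => rw [h0]
    | succ k ih => rw [(hR k).1, ih]
  apply hno j hmono
  have hball : ∀ g : X →L[ℝ] ℝ, ‖g‖ ≤ 1 →
      ∃ l : ℝ, Tendsto (fun n => g (x (j n))) atTop (𝓝 l) := by
    intro g hg
    have hbd : ∀ n, |g (x (j n))| ≤ R := by
      intro n
      have h1 := g.le_opNorm (x (j n))
      rw [Real.norm_eq_abs] at h1
      have h2 := hx (j n)
      nlinarith [norm_nonneg (x (j n)), norm_nonneg g]
    refine tendsto_of_no_upcrossings (s := Set.range ((↑) : ℚ → ℝ)) Rat.denseRange_cast ?_ ?_ ?_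
    · rintro _ ⟨a, rfl⟩ _ ⟨b, rfl⟩ hab ⟨hfa, hfb⟩
      obtain ⟨k, hk⟩ := he (a, b)
      have h2 := (hR k).2
      rw [hidx, hk] at h2
      apply h2 (by exact_mod_cast hab)
      have himg : ∀ P : ℕ → Prop, (∃ᶠ n in atTop, P (j n)) →
          {n | n ∈ (st (k + 1)).2.1 ∧ P n}.Infinite := by
        intro P hP
        have h3 : {n | P (j n) ∧ k + 1 ≤ n}.Infinite := by
          rw [← Nat.frequently_atTop_iff_infinite]
          exact hP.and_eventually (eventually_ge_atTop _)
        refine (h3.image hmono.injective.injOn).mono ?_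
        rintro _ ⟨n, hn, rfl⟩
        exact ⟨hmem _ _ hn.2, hn.1⟩
      refine ⟨⟨g, hg⟩, trivial, fun ε => ?_⟩
      cases ε
      · simpa [C] using himg (fun n => g (x n) < a) hfa
      · simpa [C] using himg (fun n => (b : ℝ) < g (x n)) hfb
    · exact isBoundedUnder_of ⟨R, fun n => (abs_le.1 (hbd n)).2⟩
    · exact isBoundedUnder_of ⟨-R, fun n => (abs_le.1 (hbd n)).1⟩
  intro f
  have hpos : 0 < ‖f‖ + 1 := by positivity
  obtain ⟨l, hl⟩ := hball ((‖f‖ + 1)⁻¹ • f) (by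
    rw [norm_smul, norm_inv, Real.norm_of_nonneg hpos.le, inv_mul_le_iff₀ hpos]
    linarith)
  refine ⟨(‖f‖ + 1) * l, ?_⟩
  convert hl.const_mul (‖f‖ + 1) using 2 with n
  simp
  field_simp

/-- The Rosenthal theorem on ℓ₁ subsequences. -/
theorem rosenthal_l1 {X : Type*} [NormedAddCommGroup X] [NormedSpace ℝ X] (x : ℕ → X)
    (hb : IsBounded (Set.range x)) :
    ∃ φ : ℕ → ℕ, StrictMono φ ∧ (IsWeaklyCauchy (x ∘ φ) ∨ IsEquivL1Basis (x ∘ φ)) := by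
  by_contra hcon
  push Not at hcon
  obtain ⟨R, hR⟩ := hb.exists_norm_le
  have hR' : ∀ n, ‖x n‖ ≤ R := fun n => hR _ ⟨n, rfl⟩
  obtain ⟨r, s, hrs, M, hM, hbad⟩ := ros_exists_bad x R hR' (fun φ hφ => (hcon φ hφ).1)
  obtain ⟨j, hj, hind⟩ := ros_indep _ M hM hbad
  refine (hcon j hj).2 ⟨(s - r) / 2, |R| + 1, by linarith, by positivity, fun n a => ⟨?_, ?_⟩⟩
  · let ε : ℕ → Bool := fun i => if h : i < n then decide (0 ≤ a ⟨i, h⟩) else true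
    obtain ⟨f, hf⟩ := hind n ε
    obtain ⟨g, hg⟩ := hind n (fun i => !(ε i))
    have hterm : ∀ i : Fin n, (s - r) * |a i| ≤ a i * (f.1 (x (j i)) - g.1 (x (j i))) := by
      intro i
      have h1 := hf i i.2
      have h2 := hg i i.2
      by_cases h : 0 ≤ a i
      · simp [ε, h] at h1 h2
        rw [abs_of_nonneg h]
        nlinarith
      · simp [ε, h] at h1 h2
        push Not at h
        rw [abs_of_neg h]
        nlinarith
    have hsum := Finset.sum_le_sum (fun i (_ : i ∈ Finset.univ) => hterm i)
    rw [← Finset.mul_sum] at hsum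
    have heq : ∑ i, a i * (f.1 (x (j i)) - g.1 (x (j i))) =
        (f.1 - g.1) (∑ i, a i • (x ∘ j) (i : ℕ)) := by
      rw [map_sum]
      exact Finset.sum_congr rfl (fun i _ => by simp)
    rw [heq] at hsum
    have h1 := (f.1 - g.1).le_opNorm (∑ i, a i • (x ∘ j) (i : ℕ))
    have h2 : ‖f.1 - g.1‖ ≤ 2 := (norm_sub_le _ _).trans (by linarith [f.2, g.2])
    have h3 := (le_abs_self _).trans h1
    have h4 := mul_le_mul_of_nonneg_right h2 (norm_nonneg (∑ i, a i • (x ∘ j) (i : ℕ)))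
    linarith
  · refine (norm_sum_le _ _).trans ?_
    rw [Finset.mul_sum]
    refine Finset.sum_le_sum (fun i _ => ?_)
    rw [norm_smul, Real.norm_eq_abs, mul_comm]
    exact mul_le_mul_of_nonneg_right ((hR' _).trans ((le_abs_self R).trans (by linarith)))
      (abs_nonneg _)

theorem l1_not_weaklyCauchy {X : Type*} [NormedAddCommGroup X] [NormedSpace ℝ X] (y : ℕ → X)
    (hy : IsEquivL1Basis y) :
    Function.Injective y ∧ ¬ IsWeaklyCauchy y := by
  obtain ⟨c, C, hc, hC, h⟩ := hy
  let Φ := Finsupp.linearCombination ℝ y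
  have hlow : ∀ a : ℕ →₀ ℝ, c * (a.sum fun _ t => |t|) ≤ ‖Φ a‖ := by
    intro a
    obtain ⟨n, hn⟩ := a.support.exists_nat_subset_range
    have := (h n (fun i => a i)).1
    rw [Fin.sum_univ_eq_sum_range (fun i => |a i|) n,
      Fin.sum_univ_eq_sum_range (fun i => a i • y i) n] at this
    rw [Finsupp.sum_of_support_subset a hn _ (by simp), Finsupp.linearCombination_apply,
      Finsupp.sum_of_support_subset a hn _ (by simp)]
    exact this
  have hinj : Function.Injective Φ := by
    rw [injective_iff_map_eq_zero]
    intro a ha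
    have h1 := hlow a
    rw [ha, norm_zero] at h1
    have h2 : (a.sum fun _ t => |t|) ≤ 0 := by nlinarith
    have h3 : (a.sum fun _ t => |t|) = 0 :=
      le_antisymm h2 (Finset.sum_nonneg (fun i _ => abs_nonneg _))
    rw [Finsupp.sum, Finset.sum_eq_zero_iff_of_nonneg (fun i _ => abs_nonneg _)] at h3
    ext i
    by_cases hi : i ∈ a.support
    · simpa using h3 i hi
    · simpa using hi
  refine ⟨LinearIndependent.injective (R := ℝ) hinj, fun hw => ?_⟩
  let ψ : (ℕ →₀ ℝ) →ₗ[ℝ] ℝ := Finsupp.linearCombination ℝ (fun n : ℕ => (-1 : ℝ) ^ n)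
  have hψ : ∀ a, |ψ a| ≤ c⁻¹ * ‖Φ a‖ := by
    intro a
    have h1 : |ψ a| ≤ a.sum fun _ t => |t| := by
      simp only [ψ, Finsupp.linearCombination_apply, Finsupp.sum]
      refine (Finset.abs_sum_le_sum_abs _ _).trans (Finset.sum_le_sum fun i _ => ?_)
      simp [abs_mul]
    rw [le_inv_mul_iff₀ hc]
    exact (mul_le_mul_of_nonneg_left h1 hc.le).trans (hlow a)
  let eqv := LinearEquiv.ofInjective Φ hinj
  let f0 : LinearMap.range Φ →L[ℝ] ℝ :=
    LinearMap.mkContinuous (ψ ∘ₗ eqv.symm.toLinearMap) c⁻¹ (by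
      intro v
      have := hψ (eqv.symm v)
      have h2 : Φ (eqv.symm v) = v := by
        have := eqv.apply_symm_apply v
        exact congrArg Subtype.val this
      rw [h2] at this
      simpa using this)
  obtain ⟨f, hf, -⟩ := exists_extension_norm_eq (LinearMap.range Φ) f0
  have hfy : ∀ n, f (y n) = (-1) ^ n := by
    intro n
    have h1 : (eqv (Finsupp.single n 1) : X) = y n := by
      simp [eqv, Φ]
    rw [← h1, hf]
    simp [f0, ψ]
  obtain ⟨l, hl⟩ := hw f
  simp only [hfy] at hl
  have he := hl.comp (tendsto_id.const_mul_atTop' (r := 2) (by norm_num))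
  have ho := hl.comp ((tendsto_add_atTop_nat 1).comp
    (tendsto_id.const_mul_atTop' (r := 2) (by norm_num)))
  have e1 : l = 1 := tendsto_nhds_unique he (by
    simp [Function.comp_def, pow_mul])
  have e2 : l = -1 := tendsto_nhds_unique ho (by
    simp [Function.comp_def, pow_mul, pow_succ])
  linarith

theorem weaklyConvergesTo_iff {X : Type*} [NormedAddCommGroup X] [NormedSpace ℝ X] (x : ℕ → X)
    (l : X) : WeaklyConvergesTo x l ↔
      ∀ f : X →L[ℝ] ℝ, Tendsto (fun n => f (x n)) atTop (𝓝 (f l)) := by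
  unfold WeaklyConvergesTo
  rw [(NormedSpace.isEmbedding_inclusionInDoubleDualWeak ℝ X).tendsto_nhds_iff,
    tendsto_iff_forall_eval_tendsto_topDualPairing]
  rfl

theorem weakly_continuous_eval {X : Type*} [NormedAddCommGroup X] [NormedSpace ℝ X]
    (f : X →L[ℝ] ℝ) : Continuous (fun z : WeakSpace ℝ X => f ((toWeakSpace ℝ X).symm z)) :=
  (WeakDual.eval_continuous f).comp (NormedSpace.inclusionInDoubleDualWeak ℝ X).continuous

theorem weaklyCauchy_bounded {X : Type*} [NormedAddCommGroup X] [NormedSpace ℝ X]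
    (x : ℕ → X) (hx : IsWeaklyCauchy x) : IsBounded (Set.range x) := by
  obtain ⟨R, hR⟩ := banach_steinhaus (g := fun n => NormedSpace.inclusionInDoubleDual ℝ X (x n))
    (by
      intro f
      obtain ⟨l, hl⟩ := hx f
      obtain ⟨B, hB⟩ := (Metric.isBounded_range_of_tendsto _ hl).exists_norm_le
      exact ⟨B, fun n => hB _ ⟨n, rfl⟩⟩)
  refine isBounded_iff_forall_norm_le.2 ⟨R, ?_⟩
  rintro _ ⟨n, rfl⟩
  rw [← (NormedSpace.inclusionInDoubleDualLi (E := X) ℝ).norm_map]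
  exact hR n

theorem three_imp_one {X : Type*} [NormedAddCommGroup X] [NormedSpace ℝ X]
    (h : ∀ A : Set X, WeaklyPrecompact A → RelWeaklyCompact A) (x : ℕ → X)
    (hx : IsWeaklyCauchy x) : ∃ l : X, WeaklyConvergesTo x l := by
  have hc := h (Set.range x) ⟨weaklyCauchy_bounded x hx, by
    intro y hy hl
    obtain ⟨hinj, hnot⟩ := l1_not_weaklyCauchy y hl
    choose k hk using hy
    have hkinj : Function.Injective k := by
      intro a b hab
      apply hinj
      rw [← hk a, ← hk b, hab]
    apply hnot
    intro f
    obtain ⟨l, hl⟩ := hx f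
    refine ⟨l, ?_⟩
    have := hl.comp hkinj.nat_tendsto_atTop
    simpa [Function.comp_def, hk] using this⟩
  obtain ⟨z, -, hz⟩ := hc.exists_mapClusterPt (f := atTop)
    (u := fun n => toWeakSpace ℝ X (x n)) (by
      refine (le_principal_iff.2 ?_)
      exact Filter.mem_map.2 (Filter.univ_mem' fun n => subset_closure ⟨x n, ⟨n, rfl⟩, rfl⟩))
  refine ⟨(toWeakSpace ℝ X).symm z, (weaklyConvergesTo_iff _ _).2 fun f => ?_⟩
  obtain ⟨l, hl⟩ := hx f
  have h1 := hz.continuousAt_comp (weakly_continuous_eval f).continuousAt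
  have h2 : MapClusterPt (f ((toWeakSpace ℝ X).symm z)) atTop (fun n => f (x n)) := h1
  have h3 : f ((toWeakSpace ℝ X).symm z) = l := by
    have : (𝓝 (f ((toWeakSpace ℝ X).symm z)) ⊓ 𝓝 l).NeBot :=
      NeBot.mono h2 (inf_le_inf_left _ hl)
    exact eq_of_nhds_neBot this
  rw [h3]
  exact hl

theorem eb_norming_aux {D : Type*} [NormedAddCommGroup D] [NormedSpace ℝ D]
    (E : Submodule ℝ (StrongDual ℝ D)) [FiniteDimensional ℝ E] :
    ∃ F : Finset D, (∀ f ∈ F, ‖f‖ ≤ 1) ∧ ∀ w ∈ E, ∃ f ∈ F, ‖w‖ ≤ 2 * |w f| := by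
  classical
  have : ProperSpace E := FiniteDimensional.proper_real E
  have hK : IsCompact (Metric.sphere (0 : E) 1) := isCompact_sphere _ _
  let U : {f : D // ‖f‖ ≤ 1} → Set E := fun f => {w | 1 / 2 < |(w : StrongDual ℝ D) f.1|}
  have hUo : ∀ f, IsOpen (U f) := by
    intro f
    refine isOpen_lt continuous_const ?_
    have : Continuous fun w : E => (w : StrongDual ℝ D) f.1 :=
      ((ContinuousLinearMap.apply ℝ ℝ f.1).continuous).comp continuous_subtype_val
    exact this.abs
  obtain ⟨t, ht⟩ := hK.elim_finite_subcover U hUo (by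
    intro w hw
    have hw1 : ‖(w : StrongDual ℝ D)‖ = 1 :=
      (mem_sphere_zero_iff_norm (E := E)).1 hw
    obtain ⟨f, hf, hlt⟩ := ContinuousLinearMap.exists_lt_apply_of_lt_opNorm
      (w : StrongDual ℝ D) (r := 1 / 2) (by rw [hw1]; norm_num)
    exact Set.mem_iUnion.2 ⟨⟨f, hf.le⟩, hlt⟩)
  refine ⟨insert 0 (t.image Subtype.val), ?_, ?_⟩
  · intro f hf
    rcases Finset.mem_insert.1 hf with rfl | hf
    · simp
    · obtain ⟨g, -, rfl⟩ := Finset.mem_image.1 hf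
      exact g.2
  · intro w hw
    by_cases h0 : w = 0
    · exact ⟨0, by simp, by simp [h0]⟩
    · have hpos : 0 < ‖w‖ := norm_pos_iff.2 h0
      have hmem : (‖w‖⁻¹ • (⟨w, hw⟩ : E)) ∈ Metric.sphere (0 : E) 1 := by
        refine (mem_sphere_zero_iff_norm (E := E)).2 ?_
        have h1 : ‖‖w‖⁻¹ • w‖ = 1 := by
          rw [norm_smul, norm_inv, norm_norm]
          exact inv_mul_cancel₀ hpos.ne'
        exact h1
      obtain ⟨f, hft, hf⟩ := Set.mem_iUnion₂.1 (ht hmem)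
      refine ⟨f.1, Finset.mem_insert_of_mem (Finset.mem_image_of_mem _ hft), ?_⟩
      have hf' : 1 / 2 < |‖w‖⁻¹ * w f.1| := hf
      rw [abs_mul, abs_of_pos (inv_pos.2 hpos), lt_inv_mul_iff₀ hpos] at hf'
      linarith

theorem eb_norming {D : Type*} [NormedAddCommGroup D] [NormedSpace ℝ D]
    (G : Finset (StrongDual ℝ D)) :
    ∃ F : Finset D, (∀ f ∈ F, ‖f‖ ≤ 1) ∧
      ∀ w ∈ Submodule.span ℝ (G : Set (StrongDual ℝ D)), ∃ f ∈ F, ‖w‖ ≤ 2 * |w f| := by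
  have : FiniteDimensional ℝ (Submodule.span ℝ (G : Set (StrongDual ℝ D))) :=
    FiniteDimensional.span_finset ℝ G
  exact eb_norming_aux _

theorem eb_mem_range {X : Type*} [NormedAddCommGroup X] [NormedSpace ℝ X] (A : Set X)
    (hseq : ∀ a : ℕ → X, (∀ n, a n ∈ A) →
      ∃ φ : ℕ → ℕ, StrictMono φ ∧ ∃ l : X, WeaklyConvergesTo (a ∘ φ) l)
    (u : StrongDual ℝ (StrongDual ℝ X))
    (hu : ∀ (F : Finset (StrongDual ℝ X)) (ε : ℝ), 0 < ε → ∃ a ∈ A, ∀ f ∈ F, |u f - f a| < ε) :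
    ∃ x : X, NormedSpace.inclusionInDoubleDual ℝ X x = u := by
  classical
  let J := NormedSpace.inclusionInDoubleDual ℝ X
  have hJ : ∀ x f, J x f = f x := fun x f => rfl
  choose F0 hF0 hF0n using eb_norming (D := StrongDual ℝ X)
  let F : Finset X → Finset (StrongDual ℝ X) := fun G =>
    G.powerset.biUnion fun G' => F0 (insert u (G'.image J))
  have hFmono : ∀ G G' : Finset X, G' ⊆ G → F0 (insert u (G'.image J)) ⊆ F G := by
    intro G G' h
    exact Finset.subset_biUnion_of_mem (fun G' : Finset X => F0 (insert u (G'.image J)))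
      (Finset.mem_powerset.2 h)
  choose α hαA hα using fun (F : Finset (StrongDual ℝ X)) (n : ℕ) =>
    hu F (1 / ((n : ℝ) + 1)) (by positivity)
  let G : ℕ → Finset X := fun n => Nat.rec ∅ (fun n G => insert (α (F G) n) G) n
  let a : ℕ → X := fun n => α (F (G n)) n
  have hG : ∀ n, G (n + 1) = insert (a n) (G n) := fun n => rfl
  have hGmono : Monotone G := monotone_nat_of_le_succ fun n => by
    rw [hG]; exact Finset.subset_insert _ _
  have haG : ∀ n, a n ∈ G (n + 1) := fun n => by rw [hG]; exact Finset.mem_insert_self _ _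
  obtain ⟨φ, hφ, x, hx⟩ := hseq a (fun n => hαA _ _)
  refine ⟨x, ?_⟩
  rw [weaklyConvergesTo_iff] at hx
  have hvan : ∀ n, ∀ f ∈ F0 (insert u ((G n).image J)), u f = f x := by
    intro n f hf
    have h1 : ∀ m, n ≤ m → |u f - f (a m)| < 1 / ((m : ℝ) + 1) := fun m hm =>
      hα _ m f (hFmono _ _ (hGmono hm) hf)
    have h2 : Tendsto (fun m => u f - f (a m)) atTop (𝓝 0) := by
      refine squeeze_zero_norm' ?_ (tendsto_one_div_add_atTop_nhds_zero_nat (𝕜 := ℝ))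
      filter_upwards [eventually_ge_atTop n] with m hm
      exact (h1 m hm).le
    have h3 := h2.comp hφ.tendsto_atTop
    have h4 : Tendsto (fun m => u f - f ((a ∘ φ) m)) atTop (𝓝 (u f - f x)) :=
      tendsto_const_nhds.sub (hx f)
    have := tendsto_nhds_unique h3 h4
    linarith
  -- `x` is in the closed span
  let V := Submodule.span ℝ (Set.range a)
  have hxV : x ∈ closure (V : Set X) := by
    have h1 : toWeakSpace ℝ X x ∈ closure (toWeakSpace ℝ X '' (V : Set X)) := by
      refine mem_closure_of_tendsto ((weaklyConvergesTo_iff _ _).2 hx) ?_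
      exact Eventually.of_forall fun n => ⟨_, Submodule.subset_span ⟨φ n, rfl⟩, rfl⟩
    rw [← (V.convex).toWeakSpace_closure (𝕜 := ℝ)] at h1
    obtain ⟨y, hy, hyx⟩ := h1
    rwa [(toWeakSpace ℝ X).injective hyx] at hy
  have hlev : ∀ v ∈ V, ∃ n, v ∈ Submodule.span ℝ (SetLike.coe (G n)) := by
    intro v hv
    induction hv using Submodule.span_induction with
    | mem v hv =>
      obtain ⟨n, rfl⟩ := hv
      exact ⟨n + 1, Submodule.subset_span (haG n)⟩
    | zero => exact ⟨0, Submodule.zero_mem _⟩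
    | add v w _ _ hv hw =>
      obtain ⟨n, hn⟩ := hv
      obtain ⟨m, hm⟩ := hw
      exact ⟨max n m, Submodule.add_mem _
        (Submodule.span_mono (Finset.coe_subset.2 (hGmono (le_max_left n m))) hn)
        (Submodule.span_mono (Finset.coe_subset.2 (hGmono (le_max_right n m))) hm)⟩
    | smul c v _ hv =>
      obtain ⟨n, hn⟩ := hv
      exact ⟨n, Submodule.smul_mem _ _ hn⟩
  have hbound : ∀ v ∈ V, ‖u - J x‖ ≤ 3 * ‖x - v‖ := by
    intro v hv
    obtain ⟨n, hn⟩ := hlev v hv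
    have hw : u - J v ∈ Submodule.span ℝ
        ((insert u ((G n).image J) : Finset _) : Set (StrongDual ℝ (StrongDual ℝ X))) := by
      refine Submodule.sub_mem _ (Submodule.subset_span (Finset.mem_coe.2 (Finset.mem_insert_self u ((G n).image J)))) ?_
      have h1 : J v ∈ (Submodule.span ℝ (SetLike.coe (G n))).map J.toLinearMap :=
        Submodule.mem_map_of_mem hn
      rw [Submodule.map_span] at h1
      refine Submodule.span_mono ?_ h1
      intro z hz
      simp only [Finset.coe_insert, Finset.coe_image]
      exact Or.inr hz
    obtain ⟨f, hf, hle⟩ := hF0n _ _ hw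
    have hf1 := hF0 _ f hf
    have hux := hvan n f hf
    have h1 : (u - J v) f = f (x - v) := by
      rw [map_sub, ← hux]; rfl
    have h2 : |f (x - v)| ≤ ‖x - v‖ := by
      have := f.le_opNorm (x - v)
      rw [Real.norm_eq_abs] at this
      nlinarith [norm_nonneg (x - v)]
    rw [h1] at hle
    have h3 : u - J x = (u - J v) - J (x - v) := by rw [map_sub]; abel
    have h4 : ‖J (x - v)‖ ≤ ‖x - v‖ := NormedSpace.double_dual_bound ℝ X _
    rw [h3]
    refine (norm_sub_le (E := StrongDual ℝ (StrongDual ℝ X)) (u - J v) (J (x - v))).trans ?_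
    linarith
  have hzero : ‖u - J x‖ ≤ 0 := by
    refine le_of_forall_pos_le_add fun ε hε => ?_
    obtain ⟨v, hv, hd⟩ := Metric.mem_closure_iff.1 hxV (ε / 3) (by positivity)
    have := hbound v hv
    rw [dist_eq_norm] at hd
    linarith
  have := (norm_le_zero_iff (E := StrongDual ℝ (StrongDual ℝ X))).1 hzero
  exact (sub_eq_zero.1 this).symm

/-- The Eberlein direction of the Eberlein-Smulian theorem. -/
theorem eberlein {X : Type*} [NormedAddCommGroup X] [NormedSpace ℝ X] (A : Set X)
    (hA : IsBounded A)
    (hseq : ∀ a : ℕ → X, (∀ n, a n ∈ A) →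
      ∃ φ : ℕ → ℕ, StrictMono φ ∧ ∃ l : X, WeaklyConvergesTo (a ∘ φ) l) :
    RelWeaklyCompact A := by
  refine NormedSpace.isCompact_closure_of_isBounded ℝ X _ ?_ ?_
  · convert hA using 1
    exact Set.preimage_image_eq _ (toWeakSpace ℝ X).injective
  · intro u hu
    obtain ⟨x, hx⟩ := eb_mem_range A hseq (WeakDual.toStrongDual u) (by
      intro F ε hε
      let O : Set (WeakDual ℝ (StrongDual ℝ X)) := {v | ∀ f ∈ F, |u f - v f| < ε}
      have hO : IsOpen O := by
        have : O = ⋂ f ∈ F, {v : WeakDual ℝ (StrongDual ℝ X) | |u f - v f| < ε} := by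
          ext v; simp [O]
        rw [this]
        refine isOpen_biInter_finset fun f _ => isOpen_lt ?_ continuous_const
        exact (continuous_const.sub (WeakDual.eval_continuous f)).abs
      obtain ⟨v, hv, hvA⟩ := mem_closure_iff.1 hu O hO (by intro f _; simpa using hε)
      obtain ⟨_, ⟨a, ha, rfl⟩, rfl⟩ := hvA
      exact ⟨a, ha, hv⟩)
    refine ⟨toWeakSpace ℝ X x, ?_⟩
    apply WeakDual.toStrongDual.injective
    exact hx

/-- For a real Banach space `X`, the following are equivalent:
(1) `X` is weakly sequentially complete;
(2) every bounded sequence in `X` has a subsequence which is either weakly convergent or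
    equivalent to the canonical basis of `ℓ₁`;
(3) every weakly precompact subset of `X` is relatively weakly compact. -/
theorem stmt0 (X : Type*) [NormedAddCommGroup X] [NormedSpace ℝ X] [CompleteSpace X] :
    List.TFAE
      [∀ x : ℕ → X, IsWeaklyCauchy x → ∃ l : X, WeaklyConvergesTo x l,
       ∀ x : ℕ → X, Bornology.IsBounded (Set.range x) →
         ∃ φ : ℕ → ℕ, StrictMono φ ∧
           ((∃ l : X, WeaklyConvergesTo (x ∘ φ) l) ∨ IsEquivL1Basis (x ∘ φ)),
       ∀ A : Set X, WeaklyPrecompact A → RelWeaklyCompact A] := by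

  tfae_have 1 → 2 := by
    intro h x hx
    obtain ⟨φ, hφ, h1 | h1⟩ := rosenthal_l1 x hx
    · exact ⟨φ, hφ, Or.inl (h _ h1)⟩
    · exact ⟨φ, hφ, Or.inr h1⟩
  tfae_have 2 → 3 := by
    rintro h A ⟨hA, hno⟩
    refine eberlein A hA fun a ha => ?_
    obtain ⟨φ, hφ, h1 | h1⟩ := h a (hA.subset (Set.range_subset_iff.2 ha))
    · exact ⟨φ, hφ, h1⟩
    · exact absurd h1 (hno _ fun n => ha _)
  tfae_have 3 → 1 := fun h x hx => three_imp_one h x hx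
  tfae_finish
end

section
/- Let X be a real Banach space, (μ_n)_{n∈ℕ} a sequence in X with ‖μ_n‖ ≤ 1 for all n, and (ε_j)_{j∈ℕ} a sequence of positive reals decreasing to 0. Let (N_j)_{j∈ℕ} be a decreasing sequence of infinite subsets of ℕ with min N_j ∉ N_{j+1} for every j, and set m_j = min N_j. Suppose that for each j there is a family (ξ^j_n)_{n∈N_j} in X such that ‖μ_n − ξ^j_n‖ ≤ ε_j for all n ∈ N_j, and such that for every infinite subset S of N_j, enumerated increasingly as (n_i)_{i∈ℕ}, the arithmetic means (1/k)·∑_{i=1}^k ξ^j_{n_i} converge in norm to 0 as k → ∞. Then the arithmetic means (1/k)·∑_{j=1}^k μ_{m_j} converge in norm to 0; in particular the subsequence (μ_{m_j})_j is Cesàro summable. -/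
open Filter Topology

/-- Diagonal argument for Cesàro summability. Let `(μ n)` be a sequence in the
unit ball of a real Banach space `X`, `(ε j)` positive reals decreasing to `0`, `(N j)` a
decreasing sequence of infinite subsets of `ℕ` with `min (N j) ∉ N (j+1)`, and suppose that for
each `j` there is a family `(ξ j n)_{n ∈ N j}` with `‖μ n - ξ j n‖ ≤ ε j` on `N j` whose
arithmetic means along every increasing enumeration of an infinite subset of `N j` tend to `0`
in norm. Then the arithmetic means of `(μ (min (N j)))_j` tend to `0` in norm; in particular
this subsequence of `(μ n)` is Cesàro summable. -/
theorem stmt10 (X : Type*) [NormedAddCommGroup X] [NormedSpace ℝ X] [CompleteSpace X]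
    (μ : ℕ → X) (hμ : ∀ n, ‖μ n‖ ≤ 1)
    (ε : ℕ → ℝ) (hεpos : ∀ j, 0 < ε j) (hεmono : Antitone ε)
    (hεlim : Tendsto ε atTop (𝓝 0))
    (N : ℕ → Set ℕ) (hNinf : ∀ j, (N j).Infinite)
    (hNdec : ∀ j, N (j + 1) ⊆ N j)
    (hmin : ∀ j, sInf (N j) ∉ N (j + 1))
    (ξ : ℕ → ℕ → X)
    (hclose : ∀ j, ∀ n ∈ N j, ‖μ n - ξ j n‖ ≤ ε j)
    (hCesaro : ∀ (j : ℕ) (e : ℕ → ℕ), StrictMono e → (∀ i, e i ∈ N j) →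
      Tendsto (fun k : ℕ => (k : ℝ)⁻¹ • ∑ i ∈ Finset.range k, ξ j (e i)) atTop (𝓝 0)) :
    Tendsto (fun k : ℕ => (k : ℝ)⁻¹ • ∑ j ∈ Finset.range k, μ (sInf (N j))) atTop (𝓝 0) := by
  have hmem : ∀ j, sInf (N j) ∈ N j := fun j => Nat.sInf_mem (hNinf j).nonempty
  have hanti : Antitone N := antitone_nat_of_succ_le hNdec
  have hmono : StrictMono fun j => sInf (N j) := by
    refine strictMono_nat_of_lt_succ fun j => ?_
    refine lt_of_le_of_ne (Nat.sInf_le (hNdec j (hmem (j + 1)))) fun h => ?_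
    apply hmin j
    rw [h]
    exact hmem (j + 1)
  rw [Metric.tendsto_atTop]
  intro δ hδ
  obtain ⟨J, hJ⟩ := (hεlim.eventually (gt_mem_nhds (show (0 : ℝ) < δ / 4 by positivity))).exists
  have hmemJ : ∀ i, sInf (N (J + i)) ∈ N J := fun i => hanti (Nat.le_add_right J i) (hmem (J + i))
  have hC := hCesaro J (fun i => sInf (N (J + i))) (fun a b hab => hmono (by omega)) hmemJ
  rw [Metric.tendsto_atTop] at hC
  obtain ⟨L, hL⟩ := hC (δ / 4) (by positivity)
  obtain ⟨K, hK⟩ := exists_nat_gt ((J : ℝ) / (δ / 4))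
  refine ⟨J + L + K + 1, fun k hk => ?_⟩
  obtain ⟨l, rfl⟩ : ∃ l, k = J + l := ⟨k - J, by omega⟩
  have hl := hL l (by omega)
  have hlpos : (0 : ℝ) < l ∨ l = 0 := by
    rcases Nat.eq_zero_or_pos l with h | h
    · exact Or.inr h
    · exact Or.inl (by exact_mod_cast h)
  have hkpos : (0 : ℝ) < ((J + l : ℕ) : ℝ) := by
    have : 0 < J + l := by omega
    exact_mod_cast this
  rw [dist_zero_right, norm_smul, norm_inv, Real.norm_natCast] at hl ⊢
  have hS : ‖∑ i ∈ Finset.range l, ξ J (sInf (N (J + i)))‖ ≤ l * (δ / 4) := by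
    rcases hlpos with h | h
    · rw [inv_mul_lt_iff₀ h] at hl
      exact hl.le
    · subst h
      simp
  have h1 : ‖∑ j ∈ Finset.range J, μ (sInf (N j))‖ ≤ J := by
    refine (norm_sum_le_of_le _ (fun j _ => hμ (sInf (N j)))).trans ?_
    simp
  have h2 : ‖∑ i ∈ Finset.range l, (μ (sInf (N (J + i))) - ξ J (sInf (N (J + i))))‖
      ≤ l * (δ / 4) := by
    refine (norm_sum_le_of_le _ (fun i _ => (hclose J _ (hmemJ i)).trans hJ.le)).trans ?_
    simp
  have h3 : (J : ℝ) < (δ / 4) * (J + l : ℕ) := by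
    rw [div_lt_iff₀ (by positivity)] at hK
    have : (K : ℝ) ≤ (J + l : ℕ) := by exact_mod_cast (by omega : K ≤ J + l)
    nlinarith
  have hsum : ∑ j ∈ Finset.range (J + l), μ (sInf (N j))
      = ∑ j ∈ Finset.range J, μ (sInf (N j))
        + (∑ i ∈ Finset.range l, (μ (sInf (N (J + i))) - ξ J (sInf (N (J + i))))
        + ∑ i ∈ Finset.range l, ξ J (sInf (N (J + i)))) := by
    rw [Finset.sum_range_add, ← Finset.sum_add_distrib]
    simp
  rw [inv_mul_lt_iff₀ hkpos, hsum]
  have h4 := norm_add_le (∑ j ∈ Finset.range J, μ (sInf (N j)))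
    (∑ i ∈ Finset.range l, (μ (sInf (N (J + i))) - ξ J (sInf (N (J + i))))
        + ∑ i ∈ Finset.range l, ξ J (sInf (N (J + i))))
  have h5 := norm_add_le
    (∑ i ∈ Finset.range l, (μ (sInf (N (J + i))) - ξ J (sInf (N (J + i)))))
    (∑ i ∈ Finset.range l, ξ J (sInf (N (J + i))))
  have h6 : (l : ℝ) * (δ / 4) ≤ ((J + l : ℕ) : ℝ) * (δ / 4) := by
    gcongr
    omega
  nlinarith [mul_pos hkpos hδ]
end

section
/- Let X be a real Banach space and W ⊆ X a bounded set. Suppose that for every ε > 0 there exists a weakly precompact set A ⊆ X such that every w ∈ W can be written as w = a + e with a ∈ A and ‖e‖ ≤ ε (i.e., W ⊆ A + ε·B_X). Then W is weakly precompact. -/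
open Filter Topology Bornology

/-- If a bounded set `W` in a real Banach space can, for every `ε > 0`, be covered
as `W ⊆ A + ε • B_X` with `A` weakly precompact (i.e. every `w ∈ W` is `w = a + e` with `a ∈ A`
and `‖e‖ ≤ ε`), then `W` is weakly precompact. -/
theorem stmt12 (X : Type*) [NormedAddCommGroup X] [NormedSpace ℝ X] [CompleteSpace X]
    (W : Set X) (hW : Bornology.IsBounded W)
    (h : ∀ ε : ℝ, 0 < ε → ∃ A : Set X, WeaklyPrecompact A ∧ ∀ w ∈ W, ∃ a ∈ A, ‖w - a‖ ≤ ε) :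
    WeaklyPrecompact W := by
  refine ⟨hW, fun x hx hxe => ?_⟩
  obtain ⟨c, C, hc, hC, hb⟩ := hxe
  obtain ⟨A, hA, hcov⟩ := h (c / 2) (by positivity)
  choose y hyA hy using fun n => hcov (x n) (hx n)
  refine hA.2 y hyA ⟨c / 2, C + c / 2, by positivity, by positivity, fun n a => ?_⟩
  obtain ⟨h1, h2⟩ := hb n a
  have h3 : ‖∑ i, a i • x (i : ℕ) - ∑ i, a i • y (i : ℕ)‖ ≤ c / 2 * ∑ i, |a i| := by
    rw [← Finset.sum_sub_distrib, Finset.mul_sum]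
    refine norm_sum_le_of_le _ fun i _ => ?_
    rw [← smul_sub, norm_smul, Real.norm_eq_abs, mul_comm]
    exact mul_le_mul_of_nonneg_right (hy i) (abs_nonneg _)
  have h4 := norm_sub_norm_le (∑ i, a i • x (i : ℕ)) (∑ i, a i • y (i : ℕ))
  have h5 := norm_sub_norm_le (∑ i, a i • y (i : ℕ)) (∑ i, a i • x (i : ℕ))
  rw [norm_sub_rev] at h5
  constructor <;> linarith
end
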